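/- arXiv:2603.17268 — 2 statements merged into one kernel-verified Lean document; each statement's English description precedes it below -/
import Mathlib

section
/- Let f ∈ C_c^∞(ℝ) and define F(x) = ∫_ℝ f(η) e^{iηx} dη. Then for every y ∈ ℝ the principal value integral p.v.∫_ℝ f(η) e^{iηy}/η dη exists and satisfies |p.v.∫_ℝ f(η) e^{iηy}/η dη| ≤ π ∫_ℝ |F(x)| dx. -/
open MeasureTheory Filter Topology

theorem abs_integral_sin_div_le_two {a b : ℝ} (ha : 1 ≤ a) (hab : a ≤ b) :
    |∫ t in a..b, Real.sin t / t| ≤ 2 := by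
  have hpos : ∀ t ∈ Set.uIcc a b, 0 < t := fun t ht => by
    rw [Set.uIcc_of_le hab] at ht
    linarith [ht.1]
  have hcos : IntervalIntegrable (fun t => Real.cos t / t ^ 2) volume a b :=
    (ContinuousOn.div (by fun_prop) (by fun_prop)
      fun t ht => pow_ne_zero 2 (hpos t ht).ne').intervalIntegrable
  have hsin : IntervalIntegrable (fun t => Real.sin t / t) volume a b :=
    (ContinuousOn.div (by fun_prop) (by fun_prop)
      fun t ht => (hpos t ht).ne').intervalIntegrable
  have hsq : IntervalIntegrable (fun t : ℝ => 1 / t ^ 2) volume a b :=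
    (ContinuousOn.div (by fun_prop) (by fun_prop)
      fun t ht => pow_ne_zero 2 (hpos t ht).ne').intervalIntegrable
  have h1 : ∫ t in a..b, (Real.sin t / t + Real.cos t / t ^ 2)
      = -Real.cos b / b - -Real.cos a / a := by
    refine intervalIntegral.integral_eq_sub_of_hasDerivAt
      (f := fun t => -Real.cos t / t) (fun t ht => ?_) (hsin.add hcos)
    have h0 := (hpos t ht).ne'
    convert! ((Real.hasDerivAt_cos t).neg).div (hasDerivAt_id t) h0 using 1
    simp only [id]
    field_simp
    simp
  have h2 : ∫ t in a..b, 1 / t ^ 2 = -1 / b - -1 / a := by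
    refine intervalIntegral.integral_eq_sub_of_hasDerivAt
      (f := fun t : ℝ => -1 / t) (fun t ht => ?_) hsq
    have h0 := (hpos t ht).ne'
    convert! (hasDerivAt_const t (-1 : ℝ)).div (hasDerivAt_id t) h0 using 1
    simp
  have h3 : |∫ t in a..b, Real.cos t / t ^ 2| ≤ ∫ t in a..b, 1 / t ^ 2 := by
    rw [← Real.norm_eq_abs]
    refine intervalIntegral.norm_integral_le_of_norm_le hab (ae_of_all _ fun t _ => ?_) hsq
    rw [Real.norm_eq_abs, abs_div, abs_of_nonneg (sq_nonneg t)]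
    gcongr
    exact Real.abs_cos_le_one t
  rw [intervalIntegral.integral_add hsin hcos] at h1
  have hb : 0 < b := by linarith
  have ha' : 0 < a := by linarith
  have h4 : |Real.cos b / b| ≤ 1 / b := by
    rw [abs_div, abs_of_pos hb]
    gcongr
    exact Real.abs_cos_le_one b
  have h5 : |Real.cos a / a| ≤ 1 / a := by
    rw [abs_div, abs_of_pos ha']
    gcongr
    exact Real.abs_cos_le_one a
  have h6 : 1 / a ≤ 1 := by rw [div_le_one ha']; exact ha
  rw [h2] at h3
  simp only [neg_div] at h1 h3
  rw [abs_le] at *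
  constructor <;> linarith [h3.1, h3.2, h4.1, h4.2, h5.1, h5.2]

theorem abs_integral_sinc_le_three {a b : ℝ} (ha : 0 ≤ a) (hab : a ≤ b) :
    |∫ t in a..b, Real.sinc t| ≤ 3 := by
  have hint : ∀ c d, IntervalIntegrable Real.sinc volume c d :=
    fun c d => Real.continuous_sinc.intervalIntegrable c d
  have small : ∀ {c d : ℝ}, 0 ≤ c → c ≤ d → d ≤ 1 → |∫ t in c..d, Real.sinc t| ≤ 1 := by
    intro c d hc hcd hd
    have := intervalIntegral.norm_integral_le_of_norm_le_const (a := c) (b := d) (C := 1)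
      (f := Real.sinc) fun x _ => Real.abs_sinc_le_one x
    rw [Real.norm_eq_abs, abs_of_nonneg (sub_nonneg.2 hcd)] at this
    linarith
  have large : ∀ {c d : ℝ}, 1 ≤ c → c ≤ d → |∫ t in c..d, Real.sinc t| ≤ 2 := by
    intro c d hc hcd
    rw [intervalIntegral.integral_congr (g := fun t => Real.sin t / t)]
    · exact abs_integral_sin_div_le_two hc hcd
    · intro t ht
      rw [Set.uIcc_of_le hcd] at ht
      exact Real.sinc_of_ne_zero (by linarith [ht.1])
  rcases le_total b 1 with hb | hb
  · linarith [small ha hab hb]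
  rcases le_total 1 a with ha1 | ha1
  · linarith [large ha1 hab]
  rw [← intervalIntegral.integral_add_adjacent_intervals (hint a 1) (hint 1 b)]
  linarith [abs_add_le (∫ t in a..1, Real.sinc t) (∫ t in (1 : ℝ)..b, Real.sinc t),
    small ha ha1 le_rfl, large le_rfl hb]

theorem abs_integral_sin_mul_div_le_three {a b : ℝ} (ha : 0 < a) (hab : a ≤ b) (c : ℝ) :
    |∫ t in a..b, Real.sin (t * c) / t| ≤ 3 := by
  have key : ∀ c : ℝ, 0 ≤ c → |∫ t in a..b, Real.sin (t * c) / t| ≤ 3 := by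
    intro c hc
    rcases hc.eq_or_lt with rfl | hc
    · simp
    have : ∫ t in a..b, Real.sin (t * c) / t = ∫ t in c * a..c * b, Real.sinc t := by
      rw [← intervalIntegral.mul_integral_comp_mul_left, ← intervalIntegral.integral_const_mul]
      refine intervalIntegral.integral_congr fun t ht => ?_
      rw [Set.uIcc_of_le hab] at ht
      have ht0 : t ≠ 0 := by linarith [ht.1]
      rw [Real.sinc_of_ne_zero (mul_ne_zero hc.ne' ht0), mul_comm t c]
      field_simp
    rw [this]
    exact abs_integral_sinc_le_three (by positivity) (by gcongr)
  rcases le_total 0 c with hc | hc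
  · exact key c hc
  · have := key (-c) (by linarith)
    simpa [mul_neg, Real.sin_neg, neg_div, intervalIntegral.integral_neg, abs_neg] using this

theorem norm_integral_integral_sin_div_le {H : ℝ → ℂ} (hH : Integrable H) {φ : ℝ → ℝ}
    (hφ : Continuous φ) {a b : ℝ} (ha : 0 < a) (hab : a ≤ b) :
    ‖∫ t in a..b, ∫ v, H v * ((Real.sin (t * φ v) / t : ℝ) : ℂ)‖ ≤ 3 * ∫ v, ‖H v‖ := by
  have hinv : Integrable (fun t : ℝ => ((t⁻¹ : ℝ) : ℂ)) (volume.restrict (Set.uIoc a b)) := by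
    have : IntervalIntegrable (fun t : ℝ => ((t⁻¹ : ℝ) : ℂ)) volume a b := by
      refine ContinuousOn.intervalIntegrable
        (Complex.continuous_ofReal.comp_continuousOn (continuousOn_id.inv₀ fun t ht => ?_))
      rw [Set.uIcc_of_le hab] at ht
      simp only [id]
      linarith [ht.1]
    exact intervalIntegrable_iff.1 this
  have hint : Integrable (Function.uncurry fun t v : ℝ =>
      H v * ((Real.sin (t * φ v) / t : ℝ) : ℂ))
      ((volume.restrict (Set.uIoc a b)).prod volume) := by
    have := (hinv.mul_prod hH).bdd_mul (c := 1)
      (f := fun z : ℝ × ℝ => ((Real.sin (z.1 * φ z.2) : ℝ) : ℂ))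
      (Continuous.aestronglyMeasurable (by fun_prop))
      (ae_of_all _ fun z => by
        rw [Complex.norm_real]
        exact Real.abs_sin_le_one _)
    refine this.congr (ae_of_all _ fun z => ?_)
    simp only [Function.uncurry]
    push_cast
    ring
  rw [intervalIntegral_integral_swap hint, ← integral_const_mul]
  refine norm_integral_le_of_norm_le (hH.norm.const_mul 3) (ae_of_all _ fun v => ?_)
  rw [intervalIntegral.integral_const_mul, intervalIntegral.integral_ofReal, norm_mul,
    Complex.norm_real, mul_comm]
  gcongr
  exact abs_integral_sin_mul_div_le_three ha hab _

theorem setIntegral_abs_mem_Icc_div {g : ℝ → ℂ} (hg : Continuous g) {a b : ℝ}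
    (ha : 0 < a) (hab : a ≤ b) :
    ∫ t in {t : ℝ | a ≤ |t| ∧ |t| ≤ b}, g t / (t : ℂ)
      = ∫ t in a..b, (g t - g (-t)) / (t : ℂ) := by
  have hset : {t : ℝ | a ≤ |t| ∧ |t| ≤ b} = Set.Icc a b ∪ Set.Icc (-b) (-a) := by
    ext t
    simp only [Set.mem_ofPred_eq, Set.mem_union, Set.mem_Icc]
    grind
  have hdisj : Disjoint (Set.Icc a b) (Set.Icc (-b) (-a)) := by
    rw [Set.disjoint_left]
    rintro t ⟨h1, _⟩ ⟨_, h2⟩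
    linarith
  have hcont : ∀ s : Set ℝ, (∀ t ∈ s, t ≠ 0) → ContinuousOn (fun t : ℝ => g t / (t : ℂ)) s :=
    fun s hs => hg.continuousOn.div (by fun_prop) fun t ht => by exact_mod_cast hs t ht
  have h1 := hcont (Set.Icc a b) fun t ht => by linarith [ht.1]
  have h2 := hcont (Set.Icc (-b) (-a)) fun t ht => by linarith [ht.2]
  have hi1 : IntervalIntegrable (fun t : ℝ => g t / (t : ℂ)) volume a b :=
    ContinuousOn.intervalIntegrable_of_Icc hab h1
  have hi2 : IntervalIntegrable (fun t : ℝ => g t / (t : ℂ)) volume (-a) (-b) :=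
    (ContinuousOn.intervalIntegrable_of_Icc (neg_le_neg hab) h2).symm
  have hi3 : IntervalIntegrable (fun t : ℝ => g (-t) / ((-t : ℝ) : ℂ)) volume a b := by
    simpa using hi2.comp_mul_left (c := (-1 : ℝ))
  rw [hset, setIntegral_union hdisj measurableSet_Icc h1.integrableOn_Icc h2.integrableOn_Icc,
    integral_Icc_eq_integral_Ioc, integral_Icc_eq_integral_Ioc,
    ← intervalIntegral.integral_of_le hab, ← intervalIntegral.integral_of_le (neg_le_neg hab),
    ← intervalIntegral.integral_comp_neg (fun t : ℝ => g t / (t : ℂ)),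
    ← intervalIntegral.integral_add hi1 hi3]
  refine intervalIntegral.integral_congr fun t _ => ?_
  rw [Complex.ofReal_neg, div_neg, sub_div, sub_eq_add_neg]

theorem exists_tendsto_integral_sub_comp_neg_div {g : ℝ → ℂ} (hg : Differentiable ℝ g)
    (hsupp : HasCompactSupport g) :
    ∃ L : ℂ, Tendsto (fun p : ℝ × ℝ => ∫ t in p.1..p.2, (g t - g (-t)) / (t : ℂ))
      ((𝓝[>] (0 : ℝ)) ×ˢ atTop) (𝓝 L) := by
  set h : ℝ → ℂ := fun t => g t - g (-t) with hh
  have hdiff : Differentiable ℝ h := hg.sub (hg.comp differentiable_neg)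
  have hcs : HasCompactSupport h :=
    hsupp.sub (hsupp.comp_homeomorph (Homeomorph.neg ℝ))
  set D := dslope h 0 with hD
  have hDne : ∀ t : ℝ, t ≠ 0 → D t = h t / (t : ℂ) := fun t ht => by
    rw [hD, dslope_of_ne _ ht, slope_def_module]
    simp [hh, div_eq_inv_mul]
  have hDc : Continuous D := by
    rw [← continuousOn_univ, hD, continuousOn_dslope univ_mem]
    exact ⟨hdiff.continuous.continuousOn, hdiff 0⟩
  have hDs : HasCompactSupport D := by
    refine HasCompactSupport.intro (hcs.isCompact.union (isCompact_singleton (x := (0 : ℝ))))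
      fun t ht => ?_
    rw [Set.mem_union, not_or] at ht
    rw [hDne t ht.2, image_eq_zero_of_notMem_tsupport ht.1, zero_div]
  have hDi : Integrable D := hDc.integrable_of_hasCompactSupport hDs
  refine ⟨(∫ t in Set.Ioi 0, D t) - 0, ?_⟩
  have h1 : Tendsto (fun R : ℝ => ∫ t in (0 : ℝ)..R, D t) atTop (𝓝 (∫ t in Set.Ioi 0, D t)) :=
    intervalIntegral_tendsto_integral_Ioi 0 hDi.integrableOn tendsto_id
  have h2 : Tendsto (fun ε : ℝ => ∫ t in (0 : ℝ)..ε, D t) (𝓝[>] 0) (𝓝 0) := by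
    have := (intervalIntegral.continuous_primitive (μ := volume)
      (fun a b => hDc.intervalIntegrable a b) 0).tendsto 0
    rw [intervalIntegral.integral_same] at this
    exact this.mono_left nhdsWithin_le_nhds
  refine ((h1.comp tendsto_snd).sub (h2.comp tendsto_fst)).congr' ?_
  filter_upwards [tendsto_fst.eventually self_mem_nhdsWithin,
    tendsto_snd.eventually (eventually_gt_atTop 0)] with p hp1 hp2
  simp only [Function.comp]
  rw [intervalIntegral.integral_interval_sub_left (hDc.intervalIntegrable _ _)
    (hDc.intervalIntegrable _ _)]
  refine intervalIntegral.integral_congr fun t ht => hDne t ?_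
  have := (lt_min hp1 hp2).trans_le ht.1
  exact this.ne'

theorem eventually_fst_pos_and_fst_le_snd :
    ∀ᶠ p : ℝ × ℝ in (𝓝[>] (0 : ℝ)) ×ˢ atTop, 0 < p.1 ∧ p.1 ≤ p.2 := by
  filter_upwards [tendsto_fst.eventually (Ioc_mem_nhdsGT (zero_lt_one (α := ℝ))),
    tendsto_snd.eventually (eventually_ge_atTop 1)] with p hp1 hp2
  exact ⟨hp1.1, hp1.2.trans hp2⟩

open FourierTransform in
/-- For `f ∈ C_c^∞(ℝ, ℂ)` with `F(x) = ∫ f(η) e^{iηx} dη`, the principal value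
integral `p.v.∫ f(η) e^{iηy}/η dη` exists for every `y` and is bounded in modulus
by `π ∫ |F|`. -/
theorem stmt1 (f : ℝ → ℂ) (hf : ContDiff ℝ (⊤ : ℕ∞) f) (hsupp : HasCompactSupport f)
    (F : ℝ → ℂ)
    (hF : ∀ x : ℝ, F x = ∫ η : ℝ, f η * Complex.exp (Complex.I * (η : ℂ) * (x : ℂ)))
    (y : ℝ) :
    ∃ L : ℂ,
      Tendsto
        (fun p : ℝ × ℝ =>
          ∫ η in {η : ℝ | p.1 ≤ |η| ∧ |η| ≤ p.2},
            f η * Complex.exp (Complex.I * (η : ℂ) * (y : ℂ)) / (η : ℂ))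
        ((𝓝[>] (0 : ℝ)) ×ˢ atTop) (𝓝 L) ∧
      ‖L‖ ≤ Real.pi * ∫ x : ℝ, ‖F x‖ := by
  set g : ℝ → ℂ := fun η => f η * Complex.exp (Complex.I * (η : ℂ) * (y : ℂ)) with hg
  have hfd : Differentiable ℝ f := hf.differentiable (by simp)
  have hgd : Differentiable ℝ g := by
    refine hfd.mul fun η => ?_
    exact (((Complex.ofRealCLM.differentiableAt (x := η)).const_mul Complex.I).mul_const
      (y : ℂ)).cexp
  have hgs : HasCompactSupport g := hsupp.mul_right
  obtain ⟨L, hL⟩ := exists_tendsto_integral_sub_comp_neg_div hgd hgs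
  refine ⟨L, hL.congr' ?_, ?_⟩
  · filter_upwards [eventually_fst_pos_and_fst_le_snd] with p hp
    exact (setIntegral_abs_mem_Icc_div hgd.continuous hp.1 hp.2).symm
  set S := hsupp.toSchwartzMap hf
  set H : ℝ → ℂ := ⇑(𝓕⁻ S : SchwartzMap ℝ ℂ) with hHdef
  have hHi : Integrable H := (𝓕⁻ S : SchwartzMap ℝ ℂ).integrable
  have hHF : ∀ v, H v = F (v * (2 * Real.pi)) := fun v => by
    rw [hHdef, SchwartzMap.fourierInv_coe, Real.fourierInv_eq', hF]
    refine integral_congr_ae (ae_of_all _ fun η => ?_)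
    change _ • f η = _
    simp only [smul_eq_mul, RCLike.inner_apply, conj_trivial]
    rw [mul_comm]
    congr 2
    push_cast
    ring
  have hFint : ∫ v, ‖H v‖ = (2 * Real.pi)⁻¹ * ∫ x, ‖F x‖ := by
    simp_rw [hHF]
    rw [Measure.integral_comp_mul_right (fun x => ‖F x‖), smul_eq_mul,
      abs_of_pos (by positivity)]
  have hfH : ∀ η : ℝ, f η =
      ∫ v, H v * Complex.exp (-(Complex.I * (2 * Real.pi * v * η : ℝ))) := by
    intro η
    have h1 : (𝓕 (𝓕⁻ S : SchwartzMap ℝ ℂ) : SchwartzMap ℝ ℂ) η = f η := by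
      rw [FourierTransform.fourier_fourierInv_eq]
      rfl
    rw [← h1, SchwartzMap.fourier_coe, Real.fourier_real_eq_integral_exp_smul]
    refine integral_congr_ae (ae_of_all _ fun v => ?_)
    simp only [smul_eq_mul]
    rw [mul_comm]
    congr 2
    push_cast
    ring
  have hgH : ∀ η : ℝ, g η =
      ∫ v, H v * Complex.exp ((η * (y - 2 * Real.pi * v) : ℝ) * Complex.I) := by
    intro η
    rw [hg]
    simp only
    rw [hfH, ← integral_mul_const]
    refine integral_congr_ae (ae_of_all _ fun v => ?_)
    simp only
    rw [mul_assoc, ← Complex.exp_add]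
    congr 2
    push_cast
    ring
  have hHexp : ∀ η : ℝ, Integrable fun v : ℝ =>
      H v * Complex.exp ((η * (y - 2 * Real.pi * v) : ℝ) * Complex.I) := fun η =>
    hHi.mul_bdd (c := 1) (Continuous.aestronglyMeasurable (by fun_prop))
      (ae_of_all _ fun v => (Complex.norm_exp_ofReal_mul_I _).le)
  have hodd : ∀ η : ℝ, (g η - g (-η)) / (η : ℂ) = (2 * Complex.I) *
      ∫ v, H v * ((Real.sin (η * (y - 2 * Real.pi * v)) / η : ℝ) : ℂ) := by
    intro η
    rw [hgH, hgH, ← integral_sub (hHexp η) (hHexp (-η)), ← integral_div, ← integral_const_mul]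
    refine integral_congr_ae (ae_of_all _ fun v => ?_)
    simp only [neg_mul, Complex.ofReal_neg, Complex.ofReal_div, Complex.ofReal_sin, Complex.sin]
    generalize ((η * (y - 2 * Real.pi * v) : ℝ) : ℂ) = w
    linear_combination (-(H v * (Complex.exp (-(w * Complex.I)) - Complex.exp (w * Complex.I))
      / (η : ℂ))) * Complex.I_sq
  have hbound : ‖L‖ ≤ 2 * (3 * ∫ v, ‖H v‖) := by
    refine le_of_tendsto hL.norm ?_
    filter_upwards [eventually_fst_pos_and_fst_le_snd] with p hp
    simp_rw [hodd]
    rw [intervalIntegral.integral_const_mul, norm_mul]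
    simp only [norm_mul, Complex.norm_I, mul_one, Complex.norm_ofNat]
    gcongr
    exact norm_integral_integral_sin_div_le hHi (by fun_prop) hp.1 hp.2
  refine hbound.trans ?_
  rw [hFint, ← mul_assoc, ← mul_assoc]
  refine mul_le_mul_of_nonneg_right ?_ (integral_nonneg fun x => norm_nonneg _)
  rw [← div_eq_mul_inv, div_le_iff₀ (by positivity)]
  nlinarith [Real.pi_gt_three]
end

section
/- Let α ∈ (0,1), A > 0, C > 0, and let a: ℝ → ℂ be twice continuously differentiable on ℝ∖{0}, supported in (−A,A), and satisfy |(η d/dη)^k a(η)| ≤ C|η|^α for k = 0,1,2 and all η ≠ 0. Then there is a constant C' depending only on C, α, A such that |∫_ℝ a(η) e^{iηx} dη| ≤ C' min(1, |x|^{−1−α}) for all x ≠ 0; consequently the function x ↦ ∫_ℝ a(η)e^{iηx}dη belongs to L¹(ℝ) with norm bounded by a constant depending only on C, α, A. -/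
open MeasureTheory Filter Topology

/-- The Euler operator `a ↦ (η ↦ η · a'(η))`. -/
noncomputable def eulerOp (a : ℝ → ℂ) : ℝ → ℂ := fun η => (η : ℂ) * deriv a η

/-- Double integration by parts against `exp (iηx)` on a bounded interval. -/
lemma integral_mul_exp_eq_of_hasDerivAt_twice {f f' f'' : ℝ → ℂ} {p q x : ℝ}
    (hpq : p ≤ q) (hx : x ≠ 0)
    (hf : ∀ t ∈ Set.Icc p q, HasDerivAt f (f' t) t)
    (hf' : ∀ t ∈ Set.Icc p q, HasDerivAt f' (f'' t) t)
    (hf'' : ContinuousOn f'' (Set.Icc p q)) (hfq : f q = 0) (hfq' : f' q = 0) :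
    (∫ t in p..q, f t * Complex.exp (Complex.I * t * x)) =
      (∫ t in p..q, f'' t * Complex.exp (Complex.I * t * x)) / (Complex.I * x) ^ 2
        + f' p * Complex.exp (Complex.I * p * x) / (Complex.I * x) ^ 2
        - f p * Complex.exp (Complex.I * p * x) / (Complex.I * x) := by
  have hix : Complex.I * (x : ℂ) ≠ 0 :=
    mul_ne_zero Complex.I_ne_zero (Complex.ofReal_ne_zero.2 hx)
  have hexp (t : ℝ) : HasDerivAt (fun t : ℝ => Complex.exp (Complex.I * t * x))
      (Complex.exp (Complex.I * t * x) * (Complex.I * x)) t := by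
    have h : HasDerivAt (fun t : ℝ => Complex.I * (t : ℂ) * (x : ℂ)) (Complex.I * 1 * x) t :=
      ((Complex.ofRealCLM.hasDerivAt (x := t)).const_mul Complex.I).mul_const (x : ℂ)
    simpa using h.cexp
  have hexpc : Continuous (fun t : ℝ => Complex.exp (Complex.I * t * x)) := by fun_prop
  have hfc : ContinuousOn f (Set.Icc p q) := fun t ht => (hf t ht).continuousAt.continuousWithinAt
  have hi : IntervalIntegrable (fun t : ℝ => f t * Complex.exp (Complex.I * t * x)) volume p q :=
    ContinuousOn.intervalIntegrable_of_Icc hpq (hfc.mul hexpc.continuousOn)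
  have hi'' : IntervalIntegrable
      (fun t : ℝ => f'' t * Complex.exp (Complex.I * t * x) / (Complex.I * x) ^ 2) volume p q :=
    ContinuousOn.intervalIntegrable_of_Icc hpq ((hf''.mul hexpc.continuousOn).div_const _)
  have key := intervalIntegral.integral_eq_sub_of_hasDerivAt
    (f := fun t : ℝ => f t * Complex.exp (Complex.I * t * x) / (Complex.I * x)
      - f' t * Complex.exp (Complex.I * t * x) / (Complex.I * x) ^ 2)
    (f' := fun t : ℝ => f t * Complex.exp (Complex.I * t * x)
      - f'' t * Complex.exp (Complex.I * t * x) / (Complex.I * x) ^ 2) (a := p) (b := q)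
    (fun t ht => by
      rw [Set.uIcc_of_le hpq] at ht
      refine ((((hf t ht).fun_mul (hexp t)).div_const (Complex.I * x)).fun_sub
        (((hf' t ht).fun_mul (hexp t)).div_const ((Complex.I * x) ^ 2))).congr_deriv ?_
      generalize Complex.exp (Complex.I * t * x) = e
      generalize Complex.I * (x : ℂ) = z at hix
      field_simp
      ring) (hi.sub hi'')
  rw [intervalIntegral.integral_sub hi hi'', intervalIntegral.integral_div, hfq, hfq'] at key
  linear_combination key

lemma norm_exp_I_mul_mul (t x : ℝ) : ‖Complex.exp (Complex.I * t * x)‖ = 1 := by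
  rw [show Complex.I * (t : ℂ) * x = ((t * x : ℝ) : ℂ) * Complex.I by push_cast; ring]
  exact Complex.norm_exp_ofReal_mul_I _

/-- Decay of the half-line Fourier integral of a symbol of order `α` vanishing beyond `A`. -/
lemma norm_setIntegral_Ioi_mul_exp_le {f f' f'' : ℝ → ℂ} {α A C x : ℝ}
    (hα : α ∈ Set.Ioo (0 : ℝ) 1) (hC : 0 ≤ C) (hx : x ≠ 0)
    (hf : ∀ t, 0 < t → HasDerivAt f (f' t) t) (hf' : ∀ t, 0 < t → HasDerivAt f' (f'' t) t)
    (hf'' : ContinuousOn f'' (Set.Ioi 0)) (hfA : ∀ t, A ≤ t → f t = 0)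
    (hb : ∀ t, 0 < t → ‖f t‖ ≤ C * t ^ α) (hb' : ∀ t, 0 < t → ‖f' t‖ ≤ C * t ^ (α - 1))
    (hb'' : ∀ t, 0 < t → ‖f'' t‖ ≤ 2 * C * t ^ (α - 2)) :
    ‖∫ t in Set.Ioi (0 : ℝ), f t * Complex.exp (Complex.I * t * x)‖
      ≤ C * (3 + 2 / (1 - α)) * |x| ^ (-1 - α) := by
  obtain ⟨hα0, hα1⟩ := hα
  have hx0 : 0 < |x| := abs_pos.2 hx
  set δ : ℝ := |x|⁻¹ with hδ
  have hδ0 : 0 < δ := inv_pos.2 hx0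
  set q : ℝ := max A δ + 1 with hq
  have hδq : δ ≤ q := (le_max_right A δ).trans (by linarith)
  have hAq : A < q := (le_max_left A δ).trans_lt (by linarith)
  have hq0 : 0 < q := hδ0.trans_le hδq
  have hpow (s : ℝ) : |x| ^ (-s) = δ ^ s := by
    rw [hδ, Real.inv_rpow hx0.le, Real.rpow_neg hx0.le]
  have hfq' : f' q = 0 := by
    refine (hf q hq0).unique ((hasDerivAt_const q (0 : ℂ)).congr_of_eventuallyEq ?_)
    filter_upwards [lt_mem_nhds hAq] with t ht using hfA t ht.le
  have hmem {t : ℝ} (ht : t ∈ Set.Icc δ q) : 0 < t := hδ0.trans_le ht.1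
  have hparts := integral_mul_exp_eq_of_hasDerivAt_twice hδq hx
    (fun t ht => hf t (hmem ht)) (fun t ht => hf' t (hmem ht))
    (hf''.mono fun t ht => hmem ht) (hfA q hAq.le) hfq'
  have hexpc : Continuous (fun t : ℝ => Complex.exp (Complex.I * t * x)) := by fun_prop
  have hfc : ContinuousOn (fun t : ℝ => f t * Complex.exp (Complex.I * t * x)) (Set.Ioi 0) :=
    ContinuousOn.mul (fun t ht => (hf t ht).continuousAt.continuousWithinAt) hexpc.continuousOn
  have hpowint : IntervalIntegrable (fun t : ℝ => C * t ^ α) volume 0 δ :=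
    (intervalIntegral.intervalIntegrable_rpow' (by linarith)).const_mul C
  have hnear_bound : ∀ t : ℝ, 0 < t → ‖f t * Complex.exp (Complex.I * t * x)‖ ≤ C * t ^ α := by
    intro t ht
    rw [norm_mul, norm_exp_I_mul_mul, mul_one]
    exact hb t ht
  have hint_near : IntervalIntegrable (fun t : ℝ => f t * Complex.exp (Complex.I * t * x))
      volume 0 δ := by
    refine hpowint.mono_fun' ?_ ?_
    · rw [Set.uIoc_of_le hδ0.le]
      exact (hfc.mono fun t ht => ht.1).aestronglyMeasurable measurableSet_Ioc
    · rw [Set.uIoc_of_le hδ0.le]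
      filter_upwards [ae_restrict_mem measurableSet_Ioc] with t ht using hnear_bound t ht.1
  have hint_far : IntervalIntegrable (fun t : ℝ => f t * Complex.exp (Complex.I * t * x))
      volume δ q :=
    ContinuousOn.intervalIntegrable_of_Icc hδq (hfc.mono fun t ht => hmem ht)
  have hsplit : (∫ t in Set.Ioi (0 : ℝ), f t * Complex.exp (Complex.I * t * x)) =
      (∫ t in (0 : ℝ)..δ, f t * Complex.exp (Complex.I * t * x)) +
        ∫ t in δ..q, f t * Complex.exp (Complex.I * t * x) := by
    rw [intervalIntegral.integral_add_adjacent_intervals hint_near hint_far,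
      intervalIntegral.integral_of_le hq0.le]
    refine setIntegral_eq_of_subset_of_forall_sdiff_eq_zero measurableSet_Ioi
      Set.Ioc_subset_Ioi_self fun t ht => ?_
    have htq : q < t := not_le.1 fun h => ht.2 ⟨ht.1, h⟩
    rw [hfA t (hAq.trans htq).le, zero_mul]
  have hnear : ‖∫ t in (0 : ℝ)..δ, f t * Complex.exp (Complex.I * t * x)‖
      ≤ C * δ ^ (1 + α) := by
    calc _ ≤ ∫ t in (0 : ℝ)..δ, C * t ^ α :=
          intervalIntegral.norm_integral_le_of_norm_le hδ0.le
            (ae_of_all _ fun t ht => hnear_bound t ht.1) hpowint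
      _ = C * (δ ^ (α + 1) / (α + 1)) := by
          rw [intervalIntegral.integral_const_mul, integral_rpow (Or.inl (by linarith)),
            Real.zero_rpow (by linarith), sub_zero]
      _ ≤ C * δ ^ (1 + α) := by
          rw [add_comm 1 α]
          gcongr
          exact div_le_self (by positivity) (by linarith)
  have hnotmem : (0 : ℝ) ∉ Set.uIcc δ q := by
    rw [Set.uIcc_of_le hδq]
    exact fun h => absurd h.1 (not_le.2 hδ0)
  have hsecond : ‖∫ t in δ..q, f'' t * Complex.exp (Complex.I * t * x)‖
      ≤ 2 * C / (1 - α) * δ ^ (α - 1) := by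
    calc _ ≤ ∫ t in δ..q, 2 * C * t ^ (α - 2) := by
          refine intervalIntegral.norm_integral_le_of_norm_le hδq (ae_of_all _ fun t ht => ?_)
            ((intervalIntegral.intervalIntegrable_rpow (Or.inr hnotmem)).const_mul _)
          rw [norm_mul, norm_exp_I_mul_mul, mul_one]
          exact hb'' t (hδ0.trans ht.1)
      _ = 2 * C / (1 - α) * (δ ^ (α - 1) - q ^ (α - 1)) := by
          rw [intervalIntegral.integral_const_mul,
            integral_rpow (Or.inr ⟨by linarith, hnotmem⟩), show α - 2 + 1 = α - 1 by ring]
          have h1 : α - 1 ≠ 0 := by linarith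
          have h2 : 1 - α ≠ 0 := by linarith
          field_simp
          ring
      _ ≤ 2 * C / (1 - α) * δ ^ (α - 1) := by
          have : 0 ≤ 2 * C / (1 - α) := div_nonneg (by linarith) (by linarith)
          gcongr
          linarith [Real.rpow_nonneg hq0.le (α - 1)]
  have hnormix : ‖Complex.I * (x : ℂ)‖ = δ⁻¹ := by simp [hδ]
  have e1 : δ ^ α * δ = δ ^ (1 + α) := by
    rw [add_comm, Real.rpow_add_one hδ0.ne']
  have e2 : δ ^ (α - 1) * δ ^ 2 = δ ^ (1 + α) := by
    rw [← Real.rpow_natCast, ← Real.rpow_add hδ0]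
    congr 1
    push_cast
    ring
  have hfar : ‖∫ t in δ..q, f t * Complex.exp (Complex.I * t * x)‖
      ≤ C * (2 + 2 / (1 - α)) * δ ^ (1 + α) := by
    rw [hparts]
    refine (norm_sub_le _ _).trans ((add_le_add_left (norm_add_le _ _) _).trans ?_)
    simp only [norm_div, norm_mul, norm_pow, norm_exp_I_mul_mul, mul_one]
    rw [← norm_mul, hnormix, inv_pow, div_inv_eq_mul, div_inv_eq_mul, div_inv_eq_mul]
    calc _ ≤ 2 * C / (1 - α) * δ ^ (α - 1) * δ ^ 2 + C * δ ^ (α - 1) * δ ^ 2 + C * δ ^ α * δ := by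
          gcongr
          · exact hb' δ hδ0
          · exact hb δ hδ0
      _ = C * (2 + 2 / (1 - α)) * δ ^ (1 + α) := by
          linear_combination (2 * C / (1 - α) + C) * e2 + C * e1
  rw [hsplit, show -1 - α = -(1 + α) by ring, hpow]
  refine (norm_add_le _ _).trans ((add_le_add hnear hfar).trans_eq ?_)
  ring

lemma min_one_rpow_le {r t : ℝ} (hr : 0 < r) (ht : 0 ≤ t) :
    min 1 (t ^ (-r)) ≤ 2 ^ r * (1 + t) ^ (-r) := by
  have h1 : 0 < 1 + t := by linarith
  rw [Real.rpow_neg h1.le, ← div_eq_mul_inv, ← Real.div_rpow zero_le_two h1.le]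
  rcases le_total t 1 with h | h
  · exact (min_le_left _ _).trans
      (Real.one_le_rpow ((one_le_div h1).2 (by linarith)) hr.le)
  · have h0 : 0 < t := by linarith
    refine (min_le_right _ _).trans ?_
    rw [Real.rpow_neg ht, ← Real.inv_rpow ht]
    refine Real.rpow_le_rpow (by positivity) ?_ hr.le
    rw [inv_eq_one_div, div_le_div_iff₀ h0 h1]
    linarith

lemma integrable_min_one_abs_rpow {r : ℝ} (hr : 1 < r) :
    Integrable (fun x : ℝ => min 1 (|x| ^ (-r))) := by
  have h : Integrable (fun x : ℝ => (2 : ℝ) ^ r * (1 + ‖x‖) ^ (-r)) :=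
    (integrable_one_add_norm (by simpa using hr)).const_mul _
  refine h.mono' (Measurable.aestronglyMeasurable (by fun_prop)) (ae_of_all _ fun x => ?_)
  rw [Real.norm_of_nonneg (by positivity)]
  exact min_one_rpow_le (by linarith) (abs_nonneg x)

lemma norm_deriv_le_of_eulerOp {a : ℝ → ℂ} {α C η : ℝ} (hη : η ≠ 0)
    (h : ‖eulerOp a η‖ ≤ C * |η| ^ α) : ‖deriv a η‖ ≤ C * |η| ^ (α - 1) := by
  have h0 : 0 < |η| := abs_pos.2 hη
  rw [Real.rpow_sub_one h0.ne', ← mul_div_assoc, le_div_iff₀ h0, mul_comm]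
  simpa [eulerOp] using h

lemma norm_deriv_deriv_le_of_eulerOp {a : ℝ → ℂ} {α C η : ℝ} (hη : η ≠ 0)
    (hd : DifferentiableAt ℝ (deriv a) η) (h1 : ‖eulerOp a η‖ ≤ C * |η| ^ α)
    (h2 : ‖eulerOp (eulerOp a) η‖ ≤ C * |η| ^ α) :
    ‖deriv (deriv a) η‖ ≤ 2 * C * |η| ^ (α - 2) := by
  have h0 : 0 < |η| := abs_pos.2 hη
  have hE : deriv (eulerOp a) η = deriv a η + η * deriv (deriv a) η := by
    have h := (Complex.ofRealCLM.hasDerivAt (x := η)).fun_mul hd.hasDerivAt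
    simpa [show eulerOp a = fun η : ℝ => (η : ℂ) * deriv a η from rfl]
      using h.deriv
  have hEE : (η : ℂ) ^ 2 * deriv (deriv a) η = eulerOp (eulerOp a) η - eulerOp a η := by
    rw [eulerOp, hE, eulerOp]
    ring
  have hn : |η| ^ 2 * ‖deriv (deriv a) η‖ ≤ 2 * C * |η| ^ α := by
    calc _ = ‖(η : ℂ) ^ 2 * deriv (deriv a) η‖ := by simp
      _ ≤ _ := by
          rw [hEE]
          exact (norm_sub_le _ _).trans (by linarith)
  rw [Real.rpow_sub h0, Real.rpow_two, ← mul_div_assoc, le_div_iff₀ (by positivity), mul_comm]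
  exact hn

/-- Stationary-phase type bound for a symbol of order `α ∈ (0,1)` supported in `(-A, A)`:
`|∫ a(η) e^{iηx} dη| ≤ C' min(1, |x|^{-1-α})`, with `C'` depending only on `C, α, A`;
in particular the resulting function of `x` is integrable with `L¹` norm `≤ C'`. -/
theorem stmt2 (α A C : ℝ) (hα : α ∈ Set.Ioo (0 : ℝ) 1) (hA : 0 < A) (hC : 0 < C) :
    ∃ C' > 0, ∀ a : ℝ → ℂ,
      ContDiffOn ℝ 2 a ({(0 : ℝ)}ᶜ) →
      Function.support a ⊆ Set.Ioo (-A) A →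
      (∀ k ≤ 2, ∀ η : ℝ, η ≠ 0 → ‖(eulerOp^[k] a) η‖ ≤ C * |η| ^ α) →
      (∀ x : ℝ, x ≠ 0 →
          ‖∫ η : ℝ, a η * Complex.exp (Complex.I * (η : ℂ) * (x : ℂ))‖
            ≤ C' * min 1 (|x| ^ (-1 - α))) ∧
      Integrable (fun x : ℝ => ∫ η : ℝ, a η * Complex.exp (Complex.I * (η : ℂ) * (x : ℂ))) ∧
      (∫ x : ℝ, ‖∫ η : ℝ, a η * Complex.exp (Complex.I * (η : ℂ) * (x : ℂ))‖) ≤ C' := by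
  obtain ⟨hα0, hα1⟩ := hα
  set M : ℝ := ∫ x : ℝ, min 1 (|x| ^ (-1 - α)) with hM
  have hM0 : 0 ≤ M := integral_nonneg fun x => by positivity
  have hminint : Integrable (fun x : ℝ => min 1 (|x| ^ (-1 - α))) := by
    have h := integrable_min_one_abs_rpow (r := 1 + α) (by linarith)
    rwa [show -(1 + α) = -1 - α by ring] at h
  set K : ℝ := C * A ^ α * (2 * A) + 2 * (C * (3 + 2 / (1 - α))) with hK
  have h1α : 0 < 1 - α := by linarith
  have hK0 : 0 < K := by positivity
  refine ⟨K * (1 + M), by positivity, fun a ha hsupp hbd => ?_⟩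
  have hopen : IsOpen ({(0 : ℝ)}ᶜ : Set ℝ) := isOpen_compl_singleton
  have hd1 : ContDiffOn ℝ 1 (deriv a) {(0 : ℝ)}ᶜ := ha.deriv_of_isOpen hopen (by norm_num)
  have hd2 : ContinuousOn (deriv (deriv a)) {(0 : ℝ)}ᶜ :=
    hd1.continuousOn_deriv_of_isOpen hopen le_rfl
  have hda {t : ℝ} (ht : t ≠ 0) : HasDerivAt a (deriv a t) t :=
    ((ha.differentiableOn (by norm_num)).differentiableAt (hopen.mem_nhds ht)).hasDerivAt
  have hdda {t : ℝ} (ht : t ≠ 0) : HasDerivAt (deriv a) (deriv (deriv a) t) t :=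
    ((hd1.differentiableOn (by norm_num)).differentiableAt (hopen.mem_nhds ht)).hasDerivAt
  have hb0 {t : ℝ} (ht : t ≠ 0) : ‖a t‖ ≤ C * |t| ^ α := hbd 0 (by norm_num) t ht
  have hb1 {t : ℝ} (ht : t ≠ 0) : ‖deriv a t‖ ≤ C * |t| ^ (α - 1) :=
    norm_deriv_le_of_eulerOp ht (hbd 1 (by norm_num) t ht)
  have hb2 {t : ℝ} (ht : t ≠ 0) : ‖deriv (deriv a) t‖ ≤ 2 * C * |t| ^ (α - 2) :=
    norm_deriv_deriv_le_of_eulerOp ht (hdda ht).differentiableAt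
      (hbd 1 (by norm_num) t ht) (hbd 2 le_rfl t ht)
  have hzero {t : ℝ} (ht : t ∉ Set.Ioo (-A) A) : a t = 0 :=
    Function.notMem_support.1 fun h => ht (hsupp h)
  have hae0 : ∀ᵐ t : ℝ, t ≠ 0 := by simp [ae_iff]
  have hmeas : AEStronglyMeasurable a volume := by
    have h := ha.continuousOn.aestronglyMeasurable (μ := volume) hopen.measurableSet
    rwa [Measure.restrict_eq_self_of_ae_mem (s := {(0 : ℝ)}ᶜ) hae0] at h
  have hbound : ∀ᵐ t : ℝ, ‖a t‖ ≤ (Set.Ioo (-A) A).indicator (fun _ => C * A ^ α) t := by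
    filter_upwards [hae0] with t ht
    by_cases htA : t ∈ Set.Ioo (-A) A
    · rw [Set.indicator_of_mem htA]
      refine (hb0 ht).trans ?_
      gcongr
      exact (abs_lt.2 htA).le
    · rw [Set.indicator_of_notMem htA, hzero htA, norm_zero]
  have hindint : Integrable ((Set.Ioo (-A) A).indicator fun _ => C * A ^ α) :=
    (integrable_indicator_iff measurableSet_Ioo).2 (integrableOn_const (by simp))
  have haint : Integrable a := hindint.mono' hmeas hbound
  have hexpm (x : ℝ) : AEStronglyMeasurable
      (fun t : ℝ => a t * Complex.exp (Complex.I * t * x)) volume :=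
    hmeas.mul (Continuous.aestronglyMeasurable (by fun_prop))
  have hint (x : ℝ) : Integrable (fun t : ℝ => a t * Complex.exp (Complex.I * t * x)) :=
    haint.mono (hexpm x) (ae_of_all _ fun t => by rw [norm_mul, norm_exp_I_mul_mul, mul_one])
  have hone (x : ℝ) : ‖∫ t : ℝ, a t * Complex.exp (Complex.I * t * x)‖ ≤ K := by
    calc _ ≤ ∫ t, (Set.Ioo (-A) A).indicator (fun _ => C * A ^ α) t := by
          refine norm_integral_le_of_norm_le hindint ?_
          filter_upwards [hbound] with t ht
          rwa [norm_mul, norm_exp_I_mul_mul, mul_one]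
      _ = C * A ^ α * (2 * A) := by
          rw [integral_indicator measurableSet_Ioo, setIntegral_const, Real.volume_real_Ioo_of_le
            (by linarith), smul_eq_mul]
          ring
      _ ≤ K := by
          rw [hK]
          have : 0 ≤ 2 * (C * (3 + 2 / (1 - α))) := by positivity
          linarith
  have hdecay (x : ℝ) (hx : x ≠ 0) :
      ‖∫ t : ℝ, a t * Complex.exp (Complex.I * t * x)‖ ≤ K * |x| ^ (-1 - α) := by
    have hpos := norm_setIntegral_Ioi_mul_exp_le (A := A) ⟨hα0, hα1⟩ hC.le hx
      (fun t ht => hda ht.ne') (fun t ht => hdda ht.ne')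
      (hd2.mono fun t ht => ne_of_gt ht) (fun t ht => hzero fun h => absurd h.2 (not_lt.2 ht))
      (fun t ht => by simpa only [abs_of_pos ht] using hb0 ht.ne')
      (fun t ht => by simpa only [abs_of_pos ht] using hb1 ht.ne')
      (fun t ht => by simpa only [abs_of_pos ht] using hb2 ht.ne')
    have hneg := norm_setIntegral_Ioi_mul_exp_le (A := A) (f := fun t => a (-t))
      (f' := fun t => -deriv a (-t)) (f'' := fun t => deriv (deriv a) (-t))
      ⟨hα0, hα1⟩ hC.le (neg_ne_zero.2 hx)
      (fun t ht => by
        simpa [Function.comp_def] using (hda (neg_ne_zero.2 ht.ne')).scomp t (hasDerivAt_neg t))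
      (fun t ht => by
        simpa [Function.comp_def] using
          ((hdda (neg_ne_zero.2 ht.ne')).scomp t (hasDerivAt_neg t)).fun_neg)
      (hd2.comp continuous_neg.continuousOn fun t ht => neg_ne_zero.2 (ne_of_gt ht))
      (fun t ht => hzero fun h => by linarith [h.1])
      (fun t ht => by simpa only [abs_neg, abs_of_pos ht] using hb0 (neg_ne_zero.2 ht.ne'))
      (fun t ht => by
        simpa only [norm_neg, abs_neg, abs_of_pos ht] using hb1 (neg_ne_zero.2 ht.ne'))
      (fun t ht => by simpa only [abs_neg, abs_of_pos ht] using hb2 (neg_ne_zero.2 ht.ne'))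
    have hrefl : (∫ t in Set.Iic (0 : ℝ), a t * Complex.exp (Complex.I * t * x)) =
        ∫ t in Set.Ioi (0 : ℝ), a (-t) * Complex.exp (Complex.I * t * (-x : ℝ)) := by
      have h := integral_comp_neg_Ioi (0 : ℝ) fun t : ℝ => a t * Complex.exp (Complex.I * t * x)
      rw [neg_zero] at h
      rw [← h]
      simp
    rw [abs_neg, ← hrefl] at hneg
    rw [← integral_add_compl measurableSet_Ioi (hint x), Set.compl_Ioi]
    refine (norm_add_le _ _).trans ((add_le_add hpos hneg).trans ?_)
    rw [← add_mul]
    gcongr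
    rw [hK]
    have : 0 ≤ C * A ^ α * (2 * A) := by positivity
    linarith
  have hmain (x : ℝ) (hx : x ≠ 0) : ‖∫ t : ℝ, a t * Complex.exp (Complex.I * t * x)‖
      ≤ K * min 1 (|x| ^ (-1 - α)) := by
    rw [mul_min_of_nonneg _ _ hK0.le, mul_one]
    exact le_min (hone x) (hdecay x hx)
  have hmain_ae : ∀ᵐ x : ℝ, ‖∫ t : ℝ, a t * Complex.exp (Complex.I * t * x)‖
      ≤ K * min 1 (|x| ^ (-1 - α)) := hae0.mono hmain
  have hcont : Continuous (fun x : ℝ => ∫ t : ℝ, a t * Complex.exp (Complex.I * t * x)) :=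
    continuous_of_dominated hexpm
      (fun x => ae_of_all _ fun t => by rw [norm_mul, norm_exp_I_mul_mul, mul_one])
      haint.norm (ae_of_all _ fun t => by fun_prop)
  have hL1 := (hminint.const_mul K).mono' hcont.aestronglyMeasurable hmain_ae
  refine ⟨fun x hx => (hmain x hx).trans ?_, hL1, ?_⟩
  · gcongr
    nlinarith
  · calc _ ≤ ∫ x : ℝ, K * min 1 (|x| ^ (-1 - α)) :=
          integral_mono_ae hL1.norm (hminint.const_mul K) hmain_ae
      _ = K * M := integral_const_mul _ _
      _ ≤ K * (1 + M) := by nlinarith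
end
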